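/- Let w : ℝ → ℝ³ and R : ℝ → M₃(ℝ) be differentiable functions with R(r)^T R(r) = I for all r, and fix a unit vector θ ∈ ℝ³. For each r define b = √(1+‖w(r)‖²), W = I + w w^T/(b+1), W^{-1} = I − w w^T/(b(b+1)), f = b + θ^T w, A = I − f^{-1}(θ + (b+1)^{-1}w)w^T, S₁ = W R^{-1} R' W (an antisymmetric matrix, where R' is the derivative of R), s₁ = *S₁ + (b+1)^{-1} w' × w, t₁ = b^{-1} S₁ w + W^{-1} w', β = r(t₁ − (θ^T t₁)θ) + r θ × s₁, and ζ(r) = f^{-1} R(w + Wθ). Then for every r: r f(r) · ζ'(r) = R A β, where ζ'(r) is the derivative of ζ with respect to r. -/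

import Mathlib

open Matrix

/-- `b = √(1+‖w‖²)`. -/
noncomputable def bOf (w : Fin 3 → ℝ) : ℝ := Real.sqrt (1 + w ⬝ᵥ w)

/-- `W = I + w wᵀ/(b+1)`. -/
noncomputable def WOf (w : Fin 3 → ℝ) : Matrix (Fin 3) (Fin 3) ℝ :=
  1 + (bOf w + 1)⁻¹ • vecMulVec w w

/-- `W⁻¹ = I − w wᵀ/(b(b+1))`. -/
noncomputable def WinvOf (w : Fin 3 → ℝ) : Matrix (Fin 3) (Fin 3) ℝ :=
  1 - (bOf w * (bOf w + 1))⁻¹ • vecMulVec w w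

/-- `f = b + θᵀw`. -/
noncomputable def fOf (θ w : Fin 3 → ℝ) : ℝ := bOf w + θ ⬝ᵥ w

/-- `A = I − f⁻¹ (θ + (b+1)⁻¹ w) wᵀ`. -/
noncomputable def AOf (θ w : Fin 3 → ℝ) : Matrix (Fin 3) (Fin 3) ℝ :=
  1 - (fOf θ w)⁻¹ • vecMulVec (θ + (bOf w + 1)⁻¹ • w) w

/-- `*S`, with components `(*S)ᵢ = ½ Σ εᵢⱼₖ Sⱼₖ`. -/
noncomputable def starVec (S : Matrix (Fin 3) (Fin 3) ℝ) : Fin 3 → ℝ :=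
  ![(S 1 2 - S 2 1) / 2, (S 2 0 - S 0 2) / 2, (S 0 1 - S 1 0) / 2]

lemma vmv_mulVec (a b x : Fin 3 → ℝ) : vecMulVec a b *ᵥ x = (b ⬝ᵥ x) • a := by
  ext i
  simp [vecMulVec, mulVec, dotProduct, Fin.sum_univ_three]
  ring

lemma bOf_sq (w : Fin 3 → ℝ) : w ⬝ᵥ w = bOf w ^ 2 - 1 := by
  have h : 0 ≤ w ⬝ᵥ w := by
    simp only [dotProduct, Fin.sum_univ_three]
    nlinarith [mul_self_nonneg (w 0), mul_self_nonneg (w 1), mul_self_nonneg (w 2)]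
  unfold bOf
  rw [Real.sq_sqrt (by linarith)]
  ring

lemma bOf_pos (w : Fin 3 → ℝ) : 0 < bOf w := by
  have h : 0 ≤ w ⬝ᵥ w := by
    simp only [dotProduct, Fin.sum_univ_three]
    nlinarith [mul_self_nonneg (w 0), mul_self_nonneg (w 1), mul_self_nonneg (w 2)]
  unfold bOf
  exact Real.sqrt_pos.mpr (by linarith)

lemma fOf_pos (θ w : Fin 3 → ℝ) (hθ : θ ⬝ᵥ θ = 1) : 0 < fOf θ w := by
  have hb := bOf_pos w
  have h2 := bOf_sq w
  have hcs : (θ ⬝ᵥ w) ^ 2 ≤ (θ ⬝ᵥ θ) * (w ⬝ᵥ w) := by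
    simp only [dotProduct, Fin.sum_univ_three]
    nlinarith [sq_nonneg (θ 0 * w 1 - θ 1 * w 0), sq_nonneg (θ 0 * w 2 - θ 2 * w 0),
      sq_nonneg (θ 1 * w 2 - θ 2 * w 1)]
  rw [hθ, h2] at hcs
  unfold fOf
  have : |θ ⬝ᵥ w| < bOf w := abs_lt_of_sq_lt_sq (by linarith) hb.le
  linarith [(abs_lt.mp this).1]

lemma dot_hasDerivAt (θ : Fin 3 → ℝ) (w : ℝ → Fin 3 → ℝ) (w' : Fin 3 → ℝ) (r : ℝ)
    (hw : HasDerivAt w w' r) : HasDerivAt (fun s => θ ⬝ᵥ w s) (θ ⬝ᵥ w') r := by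
  have h := hasDerivAt_pi.mp hw
  simp only [dotProduct]
  exact HasDerivAt.fun_sum fun i _ => (h i).const_mul (θ i)

lemma bOf_hasDerivAt (w : ℝ → Fin 3 → ℝ) (w' : Fin 3 → ℝ) (r : ℝ)
    (hw : HasDerivAt w w' r) :
    HasDerivAt (fun s => bOf (w s)) ((w r ⬝ᵥ w') / bOf (w r)) r := by
  have h := hasDerivAt_pi.mp hw
  have h1 : HasDerivAt (fun s => 1 + w s ⬝ᵥ w s) (2 * (w r ⬝ᵥ w')) r := by
    simp only [dotProduct]
    have := (HasDerivAt.fun_sum (u := Finset.univ)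
      fun i _ => (h i).fun_mul (h i)).const_add (1 : ℝ)
    refine this.congr_deriv ?_
    simp only [Fin.sum_univ_three]
    ring
  have hb := bOf_pos (w r)
  have h2 := h1.sqrt (Real.sqrt_pos.mp hb).ne'
  unfold bOf at hb ⊢
  convert h2 using 1
  field_simp

lemma mulVec_hasDerivAt (R : ℝ → Matrix (Fin 3) (Fin 3) ℝ) (R' : Matrix (Fin 3) (Fin 3) ℝ)
    (g : ℝ → Fin 3 → ℝ) (g' : Fin 3 → ℝ) (r : ℝ)
    (hR : ∀ i j, HasDerivAt (fun s => R s i j) (R' i j) r) (hg : HasDerivAt g g' r) :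
    HasDerivAt (fun s => R s *ᵥ g s) (R' *ᵥ g r + R r *ᵥ g') r := by
  have h := hasDerivAt_pi.mp hg
  refine hasDerivAt_pi.mpr fun i => ?_
  simp only [mulVec, dotProduct, Pi.add_apply]
  rw [← Finset.sum_add_distrib]
  exact HasDerivAt.fun_sum fun j _ => (hR i j).fun_mul (h j)

lemma AOf_mulVec (θ w y : Fin 3 → ℝ) :
    AOf θ w *ᵥ y = y - ((fOf θ w)⁻¹ * (w ⬝ᵥ y)) • (θ + (bOf w + 1)⁻¹ • w) := by
  rw [AOf, sub_mulVec, one_mulVec, smul_mulVec, vmv_mulVec, smul_smul]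

lemma WOf_mulVec (w y : Fin 3 → ℝ) :
    WOf w *ᵥ y = y + ((bOf w + 1)⁻¹ * (w ⬝ᵥ y)) • w := by
  rw [WOf, add_mulVec, one_mulVec, smul_mulVec, vmv_mulVec, smul_smul]

lemma WinvOf_mulVec (w y : Fin 3 → ℝ) :
    WinvOf w *ᵥ y = y - ((bOf w * (bOf w + 1))⁻¹ * (w ⬝ᵥ y)) • w := by
  rw [WinvOf, sub_mulVec, one_mulVec, smul_mulVec, vmv_mulVec, smul_smul]

lemma cross_star (θ : Fin 3 → ℝ) (S : Matrix (Fin 3) (Fin 3) ℝ) (hS : Sᵀ = -S) :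
    crossProduct θ (starVec S) = S *ᵥ θ := by
  have h : ∀ i j, S j i = - S i j := fun i j => congrFun (congrFun hS i) j
  have h0 := h 0 0
  have h1 := h 1 1
  have h2 := h 2 2
  have h00 : S 0 0 = 0 := by linarith
  have h11 : S 1 1 = 0 := by linarith
  have h22 : S 2 2 = 0 := by linarith
  ext i
  fin_cases i <;>
    simp [cross_apply, starVec, mulVec, dotProduct, Fin.sum_univ_three, h00, h11, h22,
      h 0 1, h 0 2, h 1 2] <;> ring

lemma triple_cross (θ a w : Fin 3 → ℝ) :
    crossProduct θ (crossProduct a w) = (θ ⬝ᵥ w) • a - (θ ⬝ᵥ a) • w := by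
  ext i
  fin_cases i <;>
    simp [cross_apply, dotProduct, Fin.sum_univ_three] <;> ring

lemma antisymm_dot (K : Matrix (Fin 3) (Fin 3) ℝ) (hK : Kᵀ = -K) (x y : Fin 3 → ℝ) :
    x ⬝ᵥ (K *ᵥ y) = - (y ⬝ᵥ (K *ᵥ x)) := by
  rw [dotProduct_mulVec, ← mulVec_transpose, hK, neg_mulVec, neg_dotProduct, dotProduct_comm]

/-- the rotational part of the identity -/
lemma rot_part (θ w : Fin 3 → ℝ) (hθ : θ ⬝ᵥ θ = 1) (K : Matrix (Fin 3) (Fin 3) ℝ)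
    (hK : Kᵀ = -K) (t : Fin 3 → ℝ)
    (ht : t = (bOf w)⁻¹ • ((WOf w * K * WOf w) *ᵥ w)) :
    AOf θ w *ᵥ (t - (θ ⬝ᵥ t) • θ + (WOf w * K * WOf w) *ᵥ θ)
      = K *ᵥ (w + WOf w *ᵥ θ) := by
  have hb := bOf_pos w
  have hww := bOf_sq w
  have hf := fOf_pos θ w hθ
  have hwk : w ⬝ᵥ (K *ᵥ w) = 0 := by
    have := antisymm_dot K hK w w
    linarith
  have hm := antisymm_dot K hK θ w
  have hp : fOf θ w = bOf w + θ ⬝ᵥ w := rfl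
  have ht' : t = K *ᵥ w := by
    rw [ht, ← mulVec_mulVec, ← mulVec_mulVec, WOf_mulVec w w]
    have : w + ((bOf w + 1)⁻¹ * (w ⬝ᵥ w)) • w = bOf w • w := by
      rw [hww]
      ext i
      simp only [Pi.add_apply, Pi.smul_apply, smul_eq_mul]
      field_simp
      ring
    rw [this, mulVec_smul, mulVec_smul, WOf_mulVec, hwk, smul_smul, inv_mul_cancel₀ hb.ne']
    simp
  rw [ht', ← mulVec_mulVec, ← mulVec_mulVec, AOf_mulVec]
  simp only [WOf_mulVec, mulVec_add, mulVec_smul, dotProduct_add, dotProduct_sub,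
    dotProduct_smul, smul_eq_mul, hwk, hm, hww, dotProduct_comm w θ]
  generalize w ⬝ᵥ K *ᵥ θ = m
  have hpp : θ ⬝ᵥ w = fOf θ w - bOf w := by rw [hp]; ring
  rw [hpp]
  generalize fOf θ w = f at *
  generalize bOf w = b at *
  ext i
  simp only [Pi.add_apply, Pi.sub_apply, Pi.smul_apply, smul_eq_mul]
  field_simp
  ring

/-- the boost part of the identity -/
lemma boost_part (θ w w' : Fin 3 → ℝ) (hθ : θ ⬝ᵥ θ = 1) (t : Fin 3 → ℝ)
    (ht : t = WinvOf w *ᵥ w') :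
    AOf θ w *ᵥ (t - (θ ⬝ᵥ t) • θ + crossProduct θ ((bOf w + 1)⁻¹ • crossProduct w' w))
      = (w' + ((bOf w + 1)⁻¹ * (θ ⬝ᵥ w)) • w'
          + ((bOf w + 1)⁻¹ * (θ ⬝ᵥ w')
              - (w ⬝ᵥ w') / bOf w / (bOf w + 1) ^ 2 * (θ ⬝ᵥ w)) • w)
        - ((fOf θ w)⁻¹ * ((w ⬝ᵥ w') / bOf w + θ ⬝ᵥ w')) • (w + WOf w *ᵥ θ) := by
  have hb := bOf_pos w
  have hww := bOf_sq w
  have hf := fOf_pos θ w hθ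
  have hp : fOf θ w = bOf w + θ ⬝ᵥ w := rfl
  have hpp : θ ⬝ᵥ w = fOf θ w - bOf w := by rw [hp]; ring
  rw [ht, AOf_mulVec, map_smul, triple_cross]
  simp only [WOf_mulVec, WinvOf_mulVec, dotProduct_add, dotProduct_sub,
    dotProduct_smul, smul_eq_mul, hww, dotProduct_comm w θ]
  rw [hpp]
  generalize w ⬝ᵥ w' = q
  generalize θ ⬝ᵥ w' = e
  generalize fOf θ w = f at *
  generalize bOf w = b at *
  ext i
  simp only [Pi.add_apply, Pi.sub_apply, Pi.smul_apply, smul_eq_mul]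
  field_simp
  ring

lemma zeta_hasDerivAt (θ : Fin 3 → ℝ) (hθ : θ ⬝ᵥ θ = 1) (w : ℝ → Fin 3 → ℝ)
    (w' : Fin 3 → ℝ) (r : ℝ) (hw : HasDerivAt w w' r) :
    HasDerivAt (fun s => (fOf θ (w s))⁻¹ • (w s + WOf (w s) *ᵥ θ))
      ((fOf θ (w r))⁻¹ • ((w' + ((bOf (w r) + 1)⁻¹ * (θ ⬝ᵥ w r)) • w'
          + ((bOf (w r) + 1)⁻¹ * (θ ⬝ᵥ w')
              - (w r ⬝ᵥ w') / bOf (w r) / (bOf (w r) + 1) ^ 2 * (θ ⬝ᵥ w r)) • w r)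
        - ((fOf θ (w r))⁻¹ * ((w r ⬝ᵥ w') / bOf (w r) + θ ⬝ᵥ w')) •
            (w r + WOf (w r) *ᵥ θ))) r := by
  have hb := bOf_pos (w r)
  have hf := fOf_pos θ (w r) hθ
  have hbd := bOf_hasDerivAt w w' r hw
  have hpd := dot_hasDerivAt θ w w' r hw
  have hfd : HasDerivAt (fun s => fOf θ (w s)) ((w r ⬝ᵥ w') / bOf (w r) + θ ⬝ᵥ w') r :=
    hbd.fun_add hpd
  have hfi := hfd.fun_inv hf.ne'
  have hci := (hbd.add_const 1).fun_inv (by positivity)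
  simp only [WOf_mulVec, dotProduct_comm _ θ]
  have hwi := hasDerivAt_pi.mp hw
  refine hasDerivAt_pi.mpr fun i => ?_
  have h := hfi.fun_mul ((hwi i).fun_add
    (((hci.fun_mul hpd).fun_mul (hwi i)).const_add (θ i)))
  simp only [Pi.add_apply, Pi.sub_apply, Pi.smul_apply, smul_eq_mul] at h ⊢
  refine h.congr_deriv ?_
  field_simp
  ring

/-- for `ζ(r) = f⁻¹ R (w + Wθ)` built from an `r`-dependent
rotation `R(r)` and boost `w(r)`, one has `r f(r) · ζ'(r) = R A β`, where
`β = r(t₁ − (θᵀt₁)θ) + r θ×s₁`, `S₁ = W R⁻¹ R' W`, `s₁ = *S₁ + (b+1)⁻¹ w'×w`,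
`t₁ = b⁻¹ S₁ w + W⁻¹ w'`. -/
theorem rf_zeta_deriv (θ : Fin 3 → ℝ) (hθ : Real.sqrt (θ ⬝ᵥ θ) = 1)
    (w w' : ℝ → Fin 3 → ℝ) (R R' : ℝ → Matrix (Fin 3) (Fin 3) ℝ)
    (hw : ∀ r, HasDerivAt w (w' r) r)
    (hR : ∀ r i j, HasDerivAt (fun s => R s i j) (R' r i j) r)
    (hRorth : ∀ r, (R r)ᵀ * R r = 1) :
    ∀ r : ℝ,
      let b : ℝ := bOf (w r)
      let S₁ : Matrix (Fin 3) (Fin 3) ℝ := WOf (w r) * (R r)⁻¹ * R' r * WOf (w r)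
      let s₁ : Fin 3 → ℝ := starVec S₁ + (b + 1)⁻¹ • crossProduct (w' r) (w r)
      let t₁ : Fin 3 → ℝ := b⁻¹ • (S₁ *ᵥ w r) + WinvOf (w r) *ᵥ w' r
      let β : Fin 3 → ℝ := r • (t₁ - (θ ⬝ᵥ t₁) • θ) + r • crossProduct θ s₁
      (r * fOf θ (w r)) •
          deriv (fun s => (fOf θ (w s))⁻¹ • (R s *ᵥ (w s + WOf (w s) *ᵥ θ))) r
        = R r *ᵥ (AOf θ (w r) *ᵥ β) := by
  intro r b S₁ s₁ t₁ β
  have hθ1 : θ ⬝ᵥ θ = 1 := by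
    exact Real.sqrt_eq_one.mp hθ
  have hf := fOf_pos θ (w r) hθ1
  have hinv : (R r)⁻¹ = (R r)ᵀ := inv_eq_left_inv (hRorth r)
  have hRR : R r * (R r)ᵀ = 1 := mul_eq_one_comm.mp (hRorth r)
  obtain ⟨K, hKdef⟩ : ∃ K, K = (R r)ᵀ * R' r := ⟨_, rfl⟩
  have hK : Kᵀ = -K := by
    have h0 : (R' r)ᵀ * R r + (R r)ᵀ * R' r = 0 := by
      ext i j
      have h1 : HasDerivAt (fun s => ((R s)ᵀ * R s) i j)
          (((R' r)ᵀ * R r + (R r)ᵀ * R' r) i j) r := by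
        simp only [mul_apply, transpose_apply, Matrix.add_apply]
        rw [← Finset.sum_add_distrib]
        exact HasDerivAt.fun_sum fun k _ => (hR r k i).fun_mul (hR r k j)
      have h2 : (fun s => ((R s)ᵀ * R s) i j) =
          fun _ => (1 : Matrix (Fin 3) (Fin 3) ℝ) i j := by
        funext s
        rw [hRorth s]
      rw [h2] at h1
      exact h1.unique (hasDerivAt_const r _)
    rw [hKdef, transpose_mul, transpose_transpose]
    exact eq_neg_of_add_eq_zero_left h0
  have hR' : R' r = R r * K := by
    rw [hKdef, ← Matrix.mul_assoc, hRR, Matrix.one_mul]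
  have hS₁ : S₁ = WOf (w r) * K * WOf (w r) := by
    simp only [S₁, hinv, hKdef, Matrix.mul_assoc]
  have hWt : (WOf (w r))ᵀ = WOf (w r) := by
    simp [WOf, transpose_vecMulVec]
  have hSanti : S₁ᵀ = -S₁ := by
    rw [hS₁, transpose_mul, transpose_mul, hWt, hK]
    simp [Matrix.mul_assoc]
  have hg := zeta_hasDerivAt θ hθ1 w (w' r) r (hw r)
  have hz := mulVec_hasDerivAt R (R' r) _ _ r (hR r) hg
  have hfun : (fun s => (fOf θ (w s))⁻¹ • (R s *ᵥ (w s + WOf (w s) *ᵥ θ))) =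
      fun s => R s *ᵥ ((fOf θ (w s))⁻¹ • (w s + WOf (w s) *ᵥ θ)) := by
    funext s
    rw [mulVec_smul]
  rw [hfun, hz.deriv]
  have e1 := rot_part θ (w r) hθ1 K hK _ rfl
  have e2 := boost_part θ (w r) (w' r) hθ1 _ rfl
  rw [← e2, hR', ← mulVec_mulVec, mulVec_smul K, ← e1, ← mulVec_add, ← smul_add, ← mulVec_add,
    mulVec_smul, smul_smul, mul_assoc, mul_inv_cancel₀ hf.ne', mul_one, ← mulVec_smul,
    ← mulVec_smul]
  congr 2
  rw [← hS₁]
  simp only [β, t₁, s₁, map_add, cross_star θ S₁ hSanti, dotProduct_add, b]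
  module
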